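/- arXiv:2605.23319 — 2 statements merged into one kernel-verified Lean document; each statement's English description precedes it below -/
import Mathlib

section
/- Let G be a connected finite directed acyclic graph with a single source (a unique vertex of in-degree 0), let v be a cut vertex of G, let C_1,…,C_ℓ be the connected components of G − v, and set G_i := G[V(C_i) ∪ {v}] for each i ∈ [ℓ]. If Γ_i is an optimal tree-extension of G_i for each i ∈ [ℓ], then Γ := (V, ⋃_{i∈[ℓ]} E(Γ_i)) is a tree and an optimal tree-extension of G, and nsw(G) equals the maximum of nsw(G_i) over i ∈ [ℓ]. -/
/-! Node scanwidth framework.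

A directed graph on a vertex type `V` is given by its edge relation `E : V → V → Prop`.
A rooted tree on `V` is encoded by a parent function `p : V → Option V` together with a
root `r` having no parent such that the root reaches every vertex along parent-child edges.
A tree-extension of `E` additionally requires that for every edge `u → v` of `E`,
the vertex `u` is an ancestor of `v` in the tree. -/

/-- `u` is the parent of `v` with respect to the parent function `p`. -/
def pEdge {V : Type*} (p : V → Option V) (u v : V) : Prop := p v = some u

/-- A tree-extension of the digraph with edge relation `E`. -/
structure TreeExt {V : Type*} (E : V → V → Prop) where
  parent : V → Option V
  root : V
  root_parent : parent root = none
  reach_root : ∀ v : V, Relation.ReflTransGen (pEdge parent) root v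
  extends_edges : ∀ u v : V, E u v → Relation.ReflTransGen (pEdge parent) u v

/-- The set of descendants of `v` in the tree-extension `Γ` (the vertex set of `Γ_{≤v}`). -/
def descend {V : Type*} {E : V → V → Prop} (Γ : TreeExt E) (v : V) : Set V :=
  {w | Relation.ReflTransGen (pEdge Γ.parent) v w}

/-- The node bag `GW(v, Γ)`: the `E`-parents of the subtree below `v` that lie outside it. -/
def nodeBag {V : Type*} {E : V → V → Prop} (Γ : TreeExt E) (v : V) : Set V :=
  {u | u ∉ descend Γ v ∧ ∃ w ∈ descend Γ v, E u w}

/-- The node scanwidth of a tree-extension: the maximum node-bag size. -/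
noncomputable def nswTE {V : Type*} [Fintype V] {E : V → V → Prop} (Γ : TreeExt E) : ℕ :=
  Finset.univ.sup fun v : V => (nodeBag Γ v).ncard

/-- The node scanwidth of a digraph: the minimum over all tree-extensions. -/
noncomputable def nsw {V : Type*} [Fintype V] (E : V → V → Prop) : ℕ :=
  sInf {n : ℕ | ∃ Γ : TreeExt E, nswTE Γ = n}

/-- Acyclicity of a directed graph. -/
def IsDAG {V : Type*} (E : V → V → Prop) : Prop := ∀ v : V, ¬ Relation.TransGen E v v

/-- The set of in-neighbours of `v`. -/
def parentsOf {V : Type*} (E : V → V → Prop) (v : V) : Set V := {u | E u v}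

/-- The underlying undirected (simple) graph of a digraph. -/
def underlyingGraph {V : Type*} (E : V → V → Prop) : SimpleGraph V := SimpleGraph.fromRel E

open Relation in
theorem te_no_cycle {V : Type*} {E : V → V → Prop} (Γ : TreeExt E) (x : V) :
    ¬ TransGen (pEdge Γ.parent) x x := by
  have h := Γ.reach_root x
  induction h with
  | refl =>
    intro h
    obtain ⟨d, _, hd⟩ := (TransGen.tail'_iff).1 h
    simp [pEdge, Γ.root_parent] at hd
  | @tail b c _ hbc ih =>
    intro h
    obtain ⟨d, hcd, hd⟩ := (TransGen.tail'_iff).1 h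
    have : d = b := by
      unfold pEdge at hbc hd
      rw [hbc] at hd
      exact (Option.some.inj hd).symm
    subst this
    exact ih (TransGen.head' hbc hcd)

open Relation in
theorem te_antisymm {V : Type*} {E : V → V → Prop} (Γ : TreeExt E) (x y : V)
    (h1 : ReflTransGen (pEdge Γ.parent) x y) (h2 : ReflTransGen (pEdge Γ.parent) y x) : x = y := by
  by_contra hne
  rcases reflTransGen_iff_eq_or_transGen.1 h1 with h | h
  · exact hne h.symm
  · exact te_no_cycle Γ x (h.trans_left h2)

open Relation in
theorem te_chain {V : Type*} {E : V → V → Prop} (Γ : TreeExt E) (a b c : V)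
    (h1 : ReflTransGen (pEdge Γ.parent) a c) (h2 : ReflTransGen (pEdge Γ.parent) b c) :
    ReflTransGen (pEdge Γ.parent) a b ∨ ReflTransGen (pEdge Γ.parent) b a := by
  induction h1 with
  | refl => exact Or.inr h2
  | @tail d e had hde ih =>
    rcases ReflTransGen.cases_tail h2 with h | ⟨f, hbf, hfe⟩
    · subst h; exact Or.inl (had.tail hde)
    · have : f = d := by
        unfold pEdge at hfe hde
        rw [hde] at hfe
        exact (Option.some.inj hfe).symm
      subst this
      exact ih hbf

open Relation in
theorem te_root_min {V : Type*} {E : V → V → Prop} (Γ : TreeExt E) (x : V)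
    (h : ReflTransGen (pEdge Γ.parent) x Γ.root) : x = Γ.root :=
  te_antisymm Γ _ _ h (Γ.reach_root x)

open Relation in
theorem order_parent {W : Type*} [Finite W] (R : W → W → Prop) (hr : ∀ a, R a a)
    (ht : ∀ a b c, R a b → R b c → R a c) (ha : ∀ a b, R a b → R b a → a = b)
    (hc : ∀ a b c, R a c → R b c → R a b ∨ R b a) :
    ∃ p : W → Option W, (∀ a b, ReflTransGen (pEdge p) a b ↔ R a b) ∧
      ∀ a b, p b = some a → R a b ∧ a ≠ b := by
  have wf1 : WellFounded (fun a b : W => R a b ∧ a ≠ b) := by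
    have : IsTrans W (fun a b : W => R a b ∧ a ≠ b) :=
      ⟨fun a b c h1 h2 => ⟨ht _ _ _ h1.1 h2.1, fun h => by
        subst h; exact h1.2 (ha _ _ h1.1 h2.1)⟩⟩
    have : Std.Irrefl (fun a b : W => R a b ∧ a ≠ b) := ⟨fun a h => h.2 rfl⟩
    exact Finite.wellFounded_of_trans_of_irrefl _
  have wf2 : WellFounded (fun b a : W => R a b ∧ a ≠ b) := by
    have : IsTrans W (fun b a : W => R a b ∧ a ≠ b) :=
      ⟨fun a b c h1 h2 => ⟨ht _ _ _ h2.1 h1.1, fun h => by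
        subst h; exact h1.2 (ha _ _ h1.1 h2.1)⟩⟩
    have : Std.Irrefl (fun b a : W => R a b ∧ a ≠ b) := ⟨fun a h => h.2 rfl⟩
    exact Finite.wellFounded_of_trans_of_irrefl _
  have key : ∀ x : W, ∃ o : Option W, (∀ u, o = some u → R u x ∧ u ≠ x) ∧
      ∀ y, R y x → y ≠ x → ∃ u, o = some u ∧ R y u := by
    intro x
    by_cases hx : ∃ y, R y x ∧ y ≠ x
    · obtain ⟨m, hm, hmin⟩ := wf2.has_min {y | R y x ∧ y ≠ x} hx
      refine ⟨some m, ?_, ?_⟩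
      · intro u hu
        cases hu
        exact hm
      · intro y hy hyx
        refine ⟨m, rfl, ?_⟩
        rcases hc _ _ _ hy hm.1 with h | h
        · exact h
        · by_cases hmy : m = y
          · subst hmy; exact hr _
          · exact absurd ⟨h, hmy⟩ (hmin y ⟨hy, hyx⟩)
    · refine ⟨none, by simp, fun y h1 h2 => absurd ⟨y, h1, h2⟩ hx⟩
  choose p hp1 hp2 using key
  refine ⟨p, fun a b => ⟨fun h => ?_, ?_⟩, fun a b h => hp1 b a h⟩
  · induction h with
    | refl => exact hr _
    | tail _ h2 ih => exact ht _ _ _ ih (hp1 _ _ h2).1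
  · induction b using wf1.induction with
    | _ b ih =>
      intro hab
      by_cases h : a = b
      · subst h; exact ReflTransGen.refl
      · obtain ⟨u, hu, hau⟩ := hp2 b a hab h
        exact (ih u (hp1 _ _ hu) hau).tail hu

open Relation in
theorem nsw_restrict {V : Type*} [Fintype V] [DecidableEq V] {E : V → V → Prop} (Γ : TreeExt E)
    (S : Finset V) (s : V) (hs : s ∈ S)
    (hmin : ∀ x ∈ S, ReflTransGen (pEdge Γ.parent) s x) :
    nsw (fun a b : ↥S => E a.1 b.1) ≤ nswTE Γ := by
  obtain ⟨p, hp, hp'⟩ := order_parent (fun a b : ↥S => ReflTransGen (pEdge Γ.parent) a.1 b.1)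
    (fun _ => ReflTransGen.refl) (fun _ _ _ => ReflTransGen.trans)
    (fun a b h1 h2 => Subtype.ext (te_antisymm Γ _ _ h1 h2))
    (fun a b c => te_chain Γ a.1 b.1 c.1)
  let Δ : TreeExt (fun a b : ↥S => E a.1 b.1) :=
    { parent := p
      root := ⟨s, hs⟩
      root_parent := by
        cases h : p ⟨s, hs⟩ with
        | none => rfl
        | some u =>
          obtain ⟨h1, h2⟩ := hp' _ _ h
          exact absurd (Subtype.ext (te_antisymm Γ _ _ h1 (hmin _ u.2))) h2
      reach_root := fun x => (hp _ _).2 (hmin _ x.2)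
      extends_edges := fun u w h => (hp _ _).2 (Γ.extends_edges _ _ h) }
  have h1 : nsw (fun a b : ↥S => E a.1 b.1) ≤ nswTE Δ := Nat.sInf_le ⟨Δ, rfl⟩
  refine h1.trans ?_
  refine Finset.sup_le fun x _ => ?_
  refine le_trans ?_ (Finset.le_sup (f := fun x => (nodeBag Γ x).ncard) (Finset.mem_univ x.1))
  rw [← Set.ncard_image_of_injective _ Subtype.val_injective]
  refine Set.ncard_le_ncard ?_ (Set.toFinite _)
  rintro _ ⟨u, ⟨hu, w, hw, huw⟩, rfl⟩
  exact ⟨fun h => hu ((hp _ _).2 h), w.1, (hp _ _).1 hw, huw⟩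

/-- Let `G` be a connected finite DAG with a single source `ρ`, let `v` be a cut vertex
whose removal leaves the connected components `C 0, …, C (ℓ-1)` (with `ℓ ≥ 2`), and let
`G_i` be the subgraph induced by `C i ∪ {v}`. If `Γ i` is an optimal tree-extension of
`G_i` for each `i`, then the union of the trees `Γ i` is a tree and an optimal
tree-extension of `G`, and `nsw(G)` equals the maximum of the `nsw(G_i)`. -/
theorem stmt8 {V : Type*} [Fintype V] [DecidableEq V] (E : V → V → Prop) (hdag : IsDAG E)
    (hconn : (underlyingGraph E).Connected)
    (ρ : V) (hρ : parentsOf E ρ = ∅) (hρuniq : ∀ x : V, parentsOf E x = ∅ → x = ρ)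
    (v : V) (ℓ : ℕ) (hℓ : 2 ≤ ℓ) (C : Fin ℓ → Finset V)
    (hne : ∀ i, (C i).Nonempty)
    (hdisj : ∀ i j, i ≠ j → Disjoint (C i) (C j))
    (hcover : (⋃ i, (C i : Set V)) = {x : V | x ≠ v})
    (hcomp : ∀ i, ((underlyingGraph E).induce ((C i : Set V))).Connected)
    (hsep : ∀ i j, i ≠ j → ∀ a ∈ C i, ∀ b ∈ C j, ¬ E a b)
    (Γ : ∀ i, TreeExt (fun a b : ↥(insert v (C i)) => E a.1 b.1))
    (hopt : ∀ i, nswTE (Γ i) = nsw (fun a b : ↥(insert v (C i)) => E a.1 b.1)) :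
    (∃ Γ' : TreeExt E,
      (∀ a b : V, pEdge Γ'.parent a b ↔
        ∃ (i : Fin ℓ) (ha : a ∈ insert v (C i)) (hb : b ∈ insert v (C i)),
          pEdge (Γ i).parent ⟨a, ha⟩ ⟨b, hb⟩) ∧
      nswTE Γ' = nsw E) ∧
    nsw E = Finset.univ.sup fun i => nsw (fun a b : ↥(insert v (C i)) => E a.1 b.1) := by
  have hmem : ∀ x, x ≠ v → ∃ i, x ∈ C i := by
    intro x hx
    have : x ∈ (⋃ i, (C i : Set V)) := by rw [hcover]; exact hx
    simpa using this
  have hvC : ∀ i, v ∉ C i := by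
    intro i hi
    have : v ∈ (⋃ i, (C i : Set V)) := Set.mem_iUnion.2 ⟨i, hi⟩
    rw [hcover] at this
    exact this rfl
  have huniq : ∀ i j x, x ∈ C i → x ∈ C j → i = j := by
    intro i j x hi hj
    by_contra h
    exact Finset.disjoint_left.1 (hdisj i j h) hi hj
  have hpar : ∀ i a b, b ∈ C i → E a b → a ∈ insert v (C i) := by
    intro i a b hb hab
    by_cases hav : a = v
    · simp [hav]
    · obtain ⟨j, hj⟩ := hmem a hav
      by_cases hij : j = i
      · subst hij; exact Finset.mem_insert_of_mem hj
      · exact absurd hab (hsep j i hij a hj b hb)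
  have hpex : ∀ x, x ≠ ρ → ∃ u, E u x := by
    intro x hx
    by_contra h
    push Not at h
    exact hx (hρuniq x (Set.eq_empty_iff_forall_notMem.2 h))
  have hirr : ∀ x, ¬ E x x := fun x h => hdag x (Relation.TransGen.single h)
  have hroot : ∀ i, ((Γ i).root : V) = v ∨ ((Γ i).root : V) = ρ := by
    intro i
    by_contra h
    push Not at h
    obtain ⟨h1, h2⟩ := h
    obtain ⟨u, hu⟩ := hpex _ h2
    have hrC : ((Γ i).root : V) ∈ C i := (Finset.mem_insert.1 (Γ i).root.2).resolve_left h1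
    have huS := hpar i u _ hrC hu
    have := te_root_min (Γ i) ⟨u, huS⟩ ((Γ i).extends_edges ⟨u, huS⟩ (Γ i).root hu)
    have h3 : u = ((Γ i).root : V) := congrArg Subtype.val this
    rw [h3] at hu
    exact hirr _ hu
  obtain ⟨i0, hi0⟩ : ∃ i0, ∀ j, j ≠ i0 → ((Γ j).root : V) = v := by
    by_cases hvρ : ρ = v
    · refine ⟨⟨0, by omega⟩, fun j _ => ?_⟩
      rcases hroot j with h | h
      · exact h
      · rw [h, hvρ]
    · obtain ⟨i0, h0⟩ := hmem ρ hvρ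
      refine ⟨i0, fun j hj => (hroot j).resolve_right fun h => ?_⟩
      have h1 := (Γ j).root.2
      rw [h] at h1
      exact hj (huniq _ _ ρ ((Finset.mem_insert.1 h1).resolve_left hvρ) h0)
  obtain ⟨idx, hidxm, hidxC, hidxv⟩ : ∃ idx : V → Fin ℓ, (∀ x, x ∈ insert v (C (idx x))) ∧
      (∀ i x, x ∈ C i → idx x = i) ∧ idx v = i0 := by
    have : ∀ x, ∃ i, x ∈ insert v (C i) ∧ (x = v → i = i0) := by
      intro x
      by_cases hx : x = v
      · exact ⟨i0, by simp [hx], fun _ => rfl⟩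
      · obtain ⟨i, hi⟩ := hmem x hx
        exact ⟨i, Finset.mem_insert_of_mem hi, fun h => absurd h hx⟩
    choose idx h1 h2 using this
    refine ⟨idx, h1, fun i x hx => ?_, h2 v rfl⟩
    have hxv : x ≠ v := fun h => hvC i (h ▸ hx)
    exact huniq _ _ x ((Finset.mem_insert.1 (h1 x)).resolve_left hxv) hx
  have hidx : ∀ i b, b ∈ insert v (C i) → idx b = i ∨ (b = v ∧ ((Γ i).root : V) = v) := by
    intro i b hb
    rcases Finset.mem_insert.1 hb with h | h
    · by_cases hi : i = i0
      · left; rw [h, hidxv, hi]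
      · exact Or.inr ⟨h, hi0 i hi⟩
    · exact Or.inl (hidxC i b h)
  let P : V → Option V := fun x => ((Γ (idx x)).parent ⟨x, hidxm x⟩).map Subtype.val
  have hP : ∀ a b : V, pEdge P a b ↔
        ∃ (i : Fin ℓ) (ha : a ∈ insert v (C i)) (hb : b ∈ insert v (C i)),
          pEdge (Γ i).parent ⟨a, ha⟩ ⟨b, hb⟩ := by
    intro a b
    constructor
    · intro h
      obtain ⟨u, hu, rfl⟩ := Option.map_eq_some_iff.1 h
      exact ⟨idx b, u.2, hidxm b, hu⟩
    · rintro ⟨i, ha, hb, h⟩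
      rcases hidx i b hb with h1 | ⟨h1, h2⟩
      · subst h1
        exact Option.map_eq_some_iff.2 ⟨_, h, rfl⟩
      · have : (⟨b, hb⟩ : ↥(insert v (C i))) = (Γ i).root := Subtype.ext (h1.trans h2.symm)
        unfold pEdge at h
        rw [this, (Γ i).root_parent] at h
        exact absurd h (by simp)
  have hA : ∀ i (a b : ↥(insert v (C i))), Relation.ReflTransGen (pEdge (Γ i).parent) a b →
      Relation.ReflTransGen (pEdge P) a.1 b.1 := by
    intro i a b h
    induction h with
    | refl => exact Relation.ReflTransGen.refl
    | tail _ hxy ih => exact ih.tail ((hP _ _).2 ⟨i, Subtype.property _, Subtype.property _, hxy⟩)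
  have hvS : ∀ i, v ∈ insert v (C i) := fun i => Finset.mem_insert_self _ _
  have hinter : ∀ i j b, i ≠ j → b ∈ insert v (C i) → b ∈ insert v (C j) → b = v := by
    intro i j b hij h1 h2
    by_contra hb
    exact hij (huniq i j b ((Finset.mem_insert.1 h1).resolve_left hb)
      ((Finset.mem_insert.1 h2).resolve_left hb))
  have hB : ∀ i (x : ↥(insert v (C i))) (w : V), Relation.ReflTransGen (pEdge P) x.1 w →
      (∃ hw : w ∈ insert v (C i), Relation.ReflTransGen (pEdge (Γ i).parent) x ⟨w, hw⟩) ∨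
      (w ∉ insert v (C i) ∧ Relation.ReflTransGen (pEdge (Γ i).parent) x ⟨v, hvS i⟩) := by
    intro i x w h
    induction h with
    | refl => exact Or.inl ⟨x.2, Relation.ReflTransGen.refl⟩
    | @tail b c _ hbc ih =>
      obtain ⟨j, hbj, hcj, hj⟩ := (hP _ _).1 hbc
      by_cases hji : j = i
      · subst hji
        rcases ih with ⟨hw, h⟩ | ⟨hw, h⟩
        · exact Or.inl ⟨hcj, h.tail hj⟩
        · exact absurd hbj hw
      · have hxv : Relation.ReflTransGen (pEdge (Γ i).parent) x ⟨v, hvS i⟩ := by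
          rcases ih with ⟨hw, h⟩ | ⟨hw, h⟩
          · have := hinter _ _ _ hji hbj hw
            subst this
            exact h
          · exact h
        by_cases hc : c ∈ insert v (C i)
        · have := hinter _ _ _ hji hcj hc
          subst this
          exact Or.inl ⟨hc, hxv⟩
        · exact Or.inr ⟨hc, hxv⟩
  have hrootv : ∀ j, j ≠ i0 → (Γ j).root = ⟨v, hvS j⟩ := fun j hj => Subtype.ext (hi0 j hj)
  have hvj : ∀ j, j ≠ i0 → ∀ x : ↥(insert v (C j)), Relation.ReflTransGen (pEdge P) v x.1 := by
    intro j hj x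
    have := hA j _ _ ((Γ j).reach_root x)
    rwa [hi0 j hj] at this
  let Γ' : TreeExt E :=
    { parent := P
      root := (Γ i0).root
      root_parent := by
        have h1 : idx ((Γ i0).root : V) = i0 := by
          rcases Finset.mem_insert.1 (Γ i0).root.2 with h | h
          · rw [h, hidxv]
          · exact hidxC _ _ h
        have h2 : ∀ i (hi : ((Γ i0).root : V) ∈ insert v (C i)), i = i0 →
            (Γ i).parent ⟨(Γ i0).root, hi⟩ = none := by
          intro i hi h
          subst h
          exact (Γ i).root_parent
        show Option.map _ _ = none
        rw [h2 _ _ h1]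
        rfl
      reach_root := by
        intro x
        by_cases h : idx x = i0
        · exact hA i0 _ ⟨x, h ▸ hidxm x⟩ ((Γ i0).reach_root _)
        · exact (hA i0 _ ⟨v, hvS i0⟩ ((Γ i0).reach_root _)).trans
            (hvj _ h ⟨x, hidxm x⟩)
      extends_edges := by
        intro a b hab
        have : ∃ i, a ∈ insert v (C i) ∧ b ∈ insert v (C i) := by
          by_cases hb : b = v
          · exact ⟨idx a, hidxm a, by simp [hb]⟩
          · obtain ⟨i, hi⟩ := hmem b hb
            exact ⟨i, hpar i a b hi hab, Finset.mem_insert_of_mem hi⟩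
        obtain ⟨i, ha, hb⟩ := this
        exact hA i ⟨a, ha⟩ ⟨b, hb⟩ ((Γ i).extends_edges ⟨a, ha⟩ ⟨b, hb⟩ hab) }
  have hup : nswTE Γ' ≤ Finset.univ.sup fun i =>
      nsw (fun a b : ↥(insert v (C i)) => E a.1 b.1) := by
    refine Finset.sup_le fun x _ => ?_
    refine le_trans ?_ (Finset.le_sup (Finset.mem_univ (idx x)))
    rw [← hopt]
    refine le_trans ?_ (Finset.le_sup (f := fun y => (nodeBag (Γ (idx x)) y).ncard)
      (Finset.mem_univ ⟨x, hidxm x⟩))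
    rw [← Set.ncard_image_of_injective (nodeBag (Γ (idx x)) ⟨x, hidxm x⟩) Subtype.val_injective]
    refine Set.ncard_le_ncard ?_ (Set.toFinite _)
    rintro u ⟨hu, w, hw, huw⟩
    have hu' : ¬ Relation.ReflTransGen (pEdge P) x u := hu
    have hw' : Relation.ReflTransGen (pEdge P) x w := hw
    have hxi : Relation.ReflTransGen (pEdge (Γ (idx x)).parent) ⟨x, hidxm x⟩ ⟨v, hvS _⟩ →
        idx x = i0 := by
      intro h
      by_contra hne'
      rw [← hrootv _ hne'] at h
      have h1 := te_root_min _ _ h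
      rw [hrootv _ hne'] at h1
      have h2 : x = v := congrArg Subtype.val h1
      exact hne' (by rw [h2, hidxv])
    rcases hB (idx x) ⟨x, hidxm x⟩ w hw' with ⟨hwS, h⟩ | ⟨hwS, h⟩
    · have huS : u ∈ insert v (C (idx x)) := by
        rcases Finset.mem_insert.1 hwS with hwv | hwC
        · subst hwv
          have hx0 := hxi h
          have huw' : u ≠ w := fun h => hirr w (h ▸ huw)
          obtain ⟨j, hj⟩ := hmem u huw'
          have hj0 : j = i0 := by
            by_contra hne'
            have h3 := (Γ j).extends_edges ⟨u, Finset.mem_insert_of_mem hj⟩ ⟨w, hvS j⟩ huw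
            rw [← hrootv _ hne'] at h3
            have h1 := te_root_min _ _ h3
            rw [hrootv _ hne'] at h1
            exact huw' (congrArg Subtype.val h1)
          rw [hx0, ← hj0]
          exact Finset.mem_insert_of_mem hj
        · exact hpar _ _ _ hwC huw
      refine ⟨⟨u, huS⟩, ⟨fun hd => hu' (hA _ _ _ hd), ⟨w, hwS⟩, h, huw⟩, rfl⟩
    · exfalso
      have hx0 := hxi h
      have hwv : w ≠ v := fun h => hwS (by simp [h])
      obtain ⟨j, hj⟩ := hmem w hwv
      have hj0 : j ≠ i0 := by
        intro h
        rw [hx0, ← h] at hwS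
        exact hwS (Finset.mem_insert_of_mem hj)
      exact hu' ((hA _ _ _ h).trans (hvj j hj0 ⟨u, hpar j u w hj huw⟩))
  have hle : nsw E ≤ nswTE Γ' := Nat.sInf_le ⟨Γ', rfl⟩
  have hlow : (Finset.univ.sup fun i =>
      nsw (fun a b : ↥(insert v (C i)) => E a.1 b.1)) ≤ nsw E := by
    obtain ⟨Δ, hΔ⟩ : ∃ Δ : TreeExt E, nswTE Δ = nsw E :=
      Nat.sInf_mem (s := {n : ℕ | ∃ Γ : TreeExt E, nswTE Γ = n}) ⟨_, Γ', rfl⟩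
    rw [← hΔ]
    refine Finset.sup_le fun i _ => ?_
    have hΔr : Δ.root = ρ := by
      by_contra h
      obtain ⟨u, hu⟩ := hpex _ h
      have h1 := te_root_min Δ u (Δ.extends_edges _ _ hu)
      rw [h1] at hu
      exact hirr _ hu
    by_cases hρS : ρ ∈ insert v (C i)
    · exact nsw_restrict Δ _ ρ hρS fun x _ => hΔr ▸ Δ.reach_root x
    · refine nsw_restrict Δ _ v (hvS i) fun x hx => ?_
      have wf : WellFounded (Relation.TransGen E) := by
        have : Std.Irrefl (Relation.TransGen E) := ⟨hdag⟩
        exact Finite.wellFounded_of_trans_of_irrefl _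
      induction x using wf.induction with
      | _ x ih =>
        rcases Finset.mem_insert.1 hx with h | h
        · rw [h]
        · obtain ⟨u, hu⟩ := hpex x (fun h' => hρS (h' ▸ hx))
          exact (ih u (Relation.TransGen.single hu) (hpar i u x h hu)).trans (Δ.extends_edges _ _ hu)
  exact ⟨⟨Γ', hP, le_antisymm (hup.trans hlow) hle⟩, le_antisymm (hle.trans hup) hlow⟩
end

section
/- Let N = (V,E,ω) be a phylogenetic network on taxa X, let c : X → ℕ be a cost function, and let B ∈ ℕ be a budget. Then the maximum of PD^max_N(A) over all A ⊆ X with c_Σ(A) ≤ B equals the maximum of the total weight ∑_{e∈F} ω(e) over all ∅-compatible edge sets F ⊆ E with c_Σ(V(F) ∩ X) ≤ B, where V(F) ∩ X denotes the set of taxa labeling the leaves of N contained in V(F). -/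
/-- A (rooted, edge-weighted) phylogenetic network on a finite vertex type `V` with taxa
`X`: a weakly connected DAG with a unique root of in-degree 0 and out-degree at least 2;
leaves (vertices of out-degree 0) have in-degree 1 and are bijectively labeled by `X`
via `lab`; every other vertex is a tree vertex (in-degree 1, out-degree ≥ 2) or a
reticulation vertex (in-degree 2, out-degree 1); `ω` assigns a natural-number weight to
each edge. -/
structure PhyloNet (V : Type*) (X : Type*) [Fintype V] where
  E : V → V → Prop
  ω : V → V → ℕ
  acyclic : ∀ v : V, ¬ Relation.TransGen E v v
  connected : (SimpleGraph.fromRel E).Connected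
  root : V
  root_no_parent : ∀ u : V, ¬ E u root
  root_outdeg : 2 ≤ ({w : V | E root w}).ncard
  lab : X → V
  lab_inj : Function.Injective lab
  lab_leaves : ∀ v : V, ({w : V | E v w} = ∅ ↔ ∃ x : X, lab x = v)
  leaf_indeg : ∀ x : X, ({u : V | E u (lab x)}).ncard = 1
  internal : ∀ v : V, v ≠ root → {w : V | E v w} ≠ ∅ →
      ({u : V | E u v}.ncard = 1 ∧ 2 ≤ {w : V | E v w}.ncard) ∨
      ({u : V | E u v}.ncard = 2 ∧ {w : V | E v w}.ncard = 1)

/-- The total `ω`-weight of a set of (pairs encoding) edges. -/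
noncomputable def wSum {V X : Type*} [Fintype V] (N : PhyloNet V X)
    (F : Set (V × V)) : ℕ :=
  ∑ p ∈ (Set.toFinite F).toFinset, N.ω p.1 p.2

/-- The edge `p` has offspring in `A ⊆ X`: it is an edge of `N` whose head is an ancestor
of some leaf labeled by an element of `A`. -/
def HasOffspring {V X : Type*} [Fintype V] (N : PhyloNet V X) (A : Set X)
    (p : V × V) : Prop :=
  N.E p.1 p.2 ∧ ∃ x ∈ A, Relation.ReflTransGen N.E p.2 (N.lab x)

/-- All-paths phylogenetic diversity: the total weight of all edges with offspring in `A`. -/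
noncomputable def PDmap {V X : Type*} [Fintype V] (N : PhyloNet V X) (A : Set X) : ℕ :=
  wSum N {p : V × V | HasOffspring N A p}

/-- `σ : V → V` is a switching of `N` if it selects, for every reticulation vertex `v`
(in-degree at least 2), one of its parents `σ v` (i.e. one of its incoming edges). -/
def IsSwitching {V X : Type*} [Fintype V] (N : PhyloNet V X) (σ : V → V) : Prop :=
  ∀ v : V, 2 ≤ ({u : V | N.E u v}).ncard → N.E (σ v) v

/-- The edge relation of the switching tree `T_σ`: all edges of `N` except the
reticulation edges not chosen by `σ`. -/
def switchEdge {V X : Type*} [Fintype V] (N : PhyloNet V X) (σ : V → V)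
    (u v : V) : Prop :=
  N.E u v ∧ (2 ≤ ({u' : V | N.E u' v}).ncard → σ v = u)

/-- The phylogenetic diversity of `A` in the switching tree `T_σ`: the total weight of
the edges of `T_σ` with offspring (within `T_σ`) in `A`. -/
noncomputable def PDswitch {V X : Type*} [Fintype V] (N : PhyloNet V X) (σ : V → V)
    (A : Set X) : ℕ :=
  wSum N {p : V × V | switchEdge N σ p.1 p.2 ∧
    ∃ x ∈ A, Relation.ReflTransGen (switchEdge N σ) p.2 (N.lab x)}

/-- Max-tree phylogenetic diversity: the maximum of `PD_{T_σ}(A)` over all switchings. -/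
noncomputable def PDmax {V X : Type*} [Fintype V] (N : PhyloNet V X) (A : Set X) : ℕ :=
  sSup {n : ℕ | ∃ σ : V → V, IsSwitching N σ ∧ PDswitch N σ A = n}

/-- Min-tree phylogenetic diversity: the minimum of `PD_{T_σ}(A)` over all switchings. -/
noncomputable def PDmin {V X : Type*} [Fintype V] (N : PhyloNet V X) (A : Set X) : ℕ :=
  sInf {n : ℕ | ∃ σ : V → V, IsSwitching N σ ∧ PDswitch N σ A = n}

/-- `V(F)`: the endpoints of a set of (pairs encoding) edges. -/
def VF {V : Type*} (F : Set (V × V)) : Set V :=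
  {v : V | ∃ u : V, (u, v) ∈ F ∨ (v, u) ∈ F}

/-- The total cost of a set of taxa. -/
noncomputable def costSum {X : Type*} [Finite X] (c : X → ℕ) (A : Set X) : ℕ :=
  ∑ x ∈ (Set.toFinite A).toFinset, c x

/-- `F ⊆ E` is `∅`-compatible: `N[F] = (V(F), F)` is a directed forest (every vertex has
at most one incoming `F`-edge) all of whose leaves are leaves of `N` labeled by `X`. -/
def CompatEmpty {V X : Type*} [Fintype V] (N : PhyloNet V X) (F : Set (V × V)) : Prop :=
  (∀ p ∈ F, N.E p.1 p.2) ∧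
  (∀ v : V, Set.Subsingleton {u : V | (u, v) ∈ F}) ∧
  (∀ v ∈ VF F, {w : V | (v, w) ∈ F} = ∅ → ∃ x : X, N.lab x = v)

theorem wSum_mono {V X : Type*} [Fintype V] (N : PhyloNet V X) {F G : Set (V × V)}
    (h : F ⊆ G) : wSum N F ≤ wSum N G := by
  unfold wSum
  apply Finset.sum_le_sum_of_subset
  intro p hp
  simp only [Set.Finite.mem_toFinset] at hp ⊢
  exact h hp

theorem costSum_mono {X : Type*} [Finite X] (c : X → ℕ) {F G : Set X}
    (h : F ⊆ G) : costSum c F ≤ costSum c G := by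
  unfold costSum
  apply Finset.sum_le_sum_of_subset
  intro p hp
  simp only [Set.Finite.mem_toFinset] at hp ⊢
  exact h hp

theorem PDset_bdd {V X : Type*} [Fintype V] (N : PhyloNet V X) (A : Set X) :
    wSum N Set.univ ∈ upperBounds
      {n : ℕ | ∃ σ : V → V, IsSwitching N σ ∧ PDswitch N σ A = n} := by
  rintro n ⟨σ, -, rfl⟩
  exact wSum_mono N (Set.subset_univ _)

theorem exists_switching {V X : Type*} [Fintype V] (N : PhyloNet V X) :
    ∃ σ : V → V, IsSwitching N σ := by
  classical
  have : ∀ v : V, ∃ u : V, 2 ≤ ({u : V | N.E u v}).ncard → N.E u v := by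
    intro v
    by_cases h : ∃ u, N.E u v
    · obtain ⟨u, hu⟩ := h
      exact ⟨u, fun _ => hu⟩
    · refine ⟨v, fun h2 => ?_⟩
      have : ({u : V | N.E u v}).Nonempty := by
        apply Set.nonempty_of_ncard_ne_zero; omega
      exact absurd this h
  choose σ hσ using this
  exact ⟨σ, hσ⟩

theorem no_out {V X : Type*} [Fintype V] (N : PhyloNet V X) (x : X) (w : V) :
    ¬ N.E (N.lab x) w := by
  intro h
  have := (N.lab_leaves (N.lab x)).2 ⟨x, rfl⟩
  have h2 : w ∈ {w : V | N.E (N.lab x) w} := h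
  rw [this] at h2
  exact h2

theorem compat_of_switch {V X : Type*} [Fintype V] (N : PhyloNet V X) (σ : V → V)
    (A : Set X) (F : Set (V × V)) (hF : F = {p : V × V | switchEdge N σ p.1 p.2 ∧
      ∃ x ∈ A, Relation.ReflTransGen (switchEdge N σ) p.2 (N.lab x)}) :
    CompatEmpty N F ∧ {x : X | N.lab x ∈ VF F} ⊆ A := by
  subst hF
  refine ⟨⟨fun p hp => hp.1.1, ?_, ?_⟩, ?_⟩
  · rintro v u ⟨hu, -⟩ u' ⟨hu', -⟩
    simp only at hu hu'
    by_cases h2 : 2 ≤ ({u : V | N.E u v}).ncard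
    · rw [← hu.2 h2, ← hu'.2 h2]
    · have : ({u : V | N.E u v}).ncard ≤ 1 := by omega
      exact (Set.ncard_le_one (Set.toFinite _)).1 this u hu.1 u' hu'.1
  · rintro v ⟨u, hu | hu⟩ hv
    · obtain ⟨hu, x, hx, hr⟩ := hu
      rcases Relation.ReflTransGen.cases_head hr with h | ⟨w, hw, hr'⟩
      · exact ⟨x, h.symm⟩
      · have : w ∈ ({w : V | (v, w) ∈ {p : V × V | switchEdge N σ p.1 p.2 ∧
          ∃ x ∈ A, Relation.ReflTransGen (switchEdge N σ) p.2 (N.lab x)}}) :=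
          ⟨hw, x, hx, hr'⟩
        rw [hv] at this
        exact this.elim
    · have : u ∈ ({w : V | (v, w) ∈ {p : V × V | switchEdge N σ p.1 p.2 ∧
          ∃ x ∈ A, Relation.ReflTransGen (switchEdge N σ) p.2 (N.lab x)}}) := hu
      rw [hv] at this
      exact this.elim
  · rintro x ⟨u, hu | hu⟩
    · obtain ⟨hu, y, hy, hr⟩ := hu
      rcases Relation.ReflTransGen.cases_head hr with h | ⟨w, hw, -⟩
      · rwa [N.lab_inj h]
      · exact absurd hw.1 (no_out N x w)
    · exact absurd hu.1.1 (no_out N x u)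

theorem reach_leaf {V X : Type*} [Fintype V] (N : PhyloNet V X) (F : Set (V × V))
    (hF : CompatEmpty N F) (v : V) : v ∈ VF F →
    ∃ x : X, N.lab x ∈ VF F ∧ Relation.ReflTransGen (fun a b => (a, b) ∈ F) v (N.lab x) := by
  have wf : WellFounded (fun a b : V => Relation.TransGen N.E b a) := by
    have : IsTrans V (fun a b : V => Relation.TransGen N.E b a) :=
      ⟨fun a b c h1 h2 => h2.trans h1⟩
    have : Std.Irrefl (fun a b : V => Relation.TransGen N.E b a) :=
      ⟨fun a => N.acyclic a⟩
    exact Finite.wellFounded_of_trans_of_irrefl _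
  induction v using wf.induction with
  | _ v ih =>
    intro hv
    by_cases h : {w : V | (v, w) ∈ F} = ∅
    · obtain ⟨x, rfl⟩ := hF.2.2 v hv h
      exact ⟨x, hv, Relation.ReflTransGen.refl⟩
    · obtain ⟨w, hw⟩ := Set.nonempty_iff_ne_empty.2 h
      obtain ⟨x, hx, hr⟩ := ih w (Relation.TransGen.single (hF.1 _ hw)) ⟨v, Or.inl hw⟩
      exact ⟨x, hx, Relation.ReflTransGen.head hw hr⟩

theorem switch_of_compat {V X : Type*} [Fintype V] (N : PhyloNet V X) (F : Set (V × V))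
    (hF : CompatEmpty N F) :
    ∃ σ : V → V, IsSwitching N σ ∧ wSum N F ≤ PDswitch N σ {x : X | N.lab x ∈ VF F} := by
  classical
  obtain ⟨τ, hτ⟩ := exists_switching N
  let σ : V → V := fun v => if h : ∃ u, (u, v) ∈ F then h.choose else τ v
  have hσF : ∀ u v, (u, v) ∈ F → σ v = u := by
    intro u v h
    have h' : ∃ u, (u, v) ∈ F := ⟨u, h⟩
    have : σ v = h'.choose := dif_pos h'
    rw [this]
    exact hF.2.1 v h'.choose_spec h
  have hsw : ∀ u v, (u, v) ∈ F → switchEdge N σ u v :=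
    fun u v h => ⟨hF.1 _ h, fun _ => hσF u v h⟩
  refine ⟨σ, ?_, ?_⟩
  · intro v h2
    by_cases h : ∃ u, (u, v) ∈ F
    · obtain ⟨u, hu⟩ := h
      rw [hσF u v hu]
      exact hF.1 _ hu
    · have : σ v = τ v := dif_neg h
      rw [this]
      exact hτ v h2
  · apply wSum_mono
    rintro ⟨u, v⟩ h
    obtain ⟨x, hx, hr⟩ := reach_leaf N F hF v ⟨u, Or.inl h⟩
    exact ⟨hsw u v h, x, hx, Relation.ReflTransGen.mono (fun a b hab => hsw a b hab) _ _ hr⟩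

/-- For a phylogenetic network `N` on taxa `X`, costs `c` and budget `B`, the maximum of
`PD^max_N(A)` over all `A ⊆ X` with `c_Σ(A) ≤ B` equals the maximum of `∑_{e ∈ F} ω(e)`
over all `∅`-compatible edge sets `F ⊆ E` with `c_Σ(V(F) ∩ X) ≤ B`. -/
theorem stmt13 {V X : Type*} [Fintype V] [Fintype X] (N : PhyloNet V X)
    (c : X → ℕ) (B : ℕ) :
    sSup {n : ℕ | ∃ A : Set X, costSum c A ≤ B ∧ PDmax N A = n} =
    sSup {n : ℕ | ∃ F : Set (V × V), CompatEmpty N F ∧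
      costSum c {x : X | N.lab x ∈ VF F} ≤ B ∧ wSum N F = n} := by
  have hub : ∀ A : Set X, PDmax N A ≤ wSum N Set.univ := by
    intro A
    obtain ⟨τ, hτ⟩ := exists_switching N
    exact csSup_le ⟨_, τ, hτ, rfl⟩ (PDset_bdd N A)
  have hempty : costSum c (∅ : Set X) = 0 := by simp [costSum]
  apply le_antisymm
  · apply csSup_le
    · exact ⟨_, ∅, by rw [hempty]; exact Nat.zero_le _, rfl⟩
    · rintro n ⟨A, hA, rfl⟩
      obtain ⟨τ, hτ⟩ := exists_switching N
      have hmem := Nat.sSup_mem (s := {n : ℕ | ∃ σ : V → V, IsSwitching N σ ∧ PDswitch N σ A = n})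
        ⟨_, τ, hτ, rfl⟩ ⟨_, PDset_bdd N A⟩
      obtain ⟨σ, hσ, hval⟩ := hmem
      obtain ⟨h1, h2⟩ := compat_of_switch N σ A _ rfl
      apply le_csSup
      · refine ⟨wSum N Set.univ, ?_⟩
        rintro n ⟨F, -, -, rfl⟩
        exact wSum_mono N (Set.subset_univ _)
      · exact ⟨_, h1, (costSum_mono c h2).trans hA, hval⟩
  · apply csSup_le
    · refine ⟨_, ∅, ⟨by simp, by intro v; simp, by rintro v ⟨u, h | h⟩ <;> exact h.elim⟩, ?_, rfl⟩
      have : {x : X | N.lab x ∈ VF (∅ : Set (V × V))} = ∅ := by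
        ext x; simp [VF]
      rw [this, hempty]; exact Nat.zero_le _
    · rintro n ⟨F, hF, hc, rfl⟩
      obtain ⟨σ, hσ, hle⟩ := switch_of_compat N F hF
      refine hle.trans (le_trans (le_csSup ⟨_, PDset_bdd N _⟩ ⟨σ, hσ, rfl⟩) ?_)
      apply le_csSup
      · refine ⟨wSum N Set.univ, ?_⟩
        rintro n ⟨A, -, rfl⟩
        exact hub A
      · exact ⟨_, hc, rfl⟩
end
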